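/- arXiv:2203.15409 — 2 statements merged into one kernel-verified Lean document; each statement's English description precedes it below -/
import Mathlib

section
/- Let d, m, n be positive integers, let p_1, …, p_d be positive reals, and for each i ∈ {1,…,d} let F_i ∈ ℝ^{m×m}, A_i ∈ ℝ^{n×n}, B_i ∈ ℝ^{m×n}. Define the (m+n)×(m+n) block matrices F̃_i = [[F_i, B_i],[0, A_i]]. If both Σ_{i=1}^d p_i (F_i ⊗ F_i) and Σ_{i=1}^d p_i (A_i ⊗ A_i) are Schur stable, then Σ_{i=1}^d p_i (F̃_i ⊗ F̃_i) is Schur stable. -/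
open Matrix
open scoped Kronecker

/-- Word product `M_w = M_{σ_k} ⋯ M_{σ_1}` for a word `w = σ_1 ⋯ σ_k`,
represented as a list `[σ_1, …, σ_k]`; `M_ε = 1`. -/
noncomputable def wordProd {d : ℕ} {ι : Type} [Fintype ι] [DecidableEq ι]
    (A : Fin d → Matrix ι ι ℝ) : List (Fin d) → Matrix ι ι ℝ
  | [] => 1
  | σ :: s => wordProd A s * A σ

/-- A real square matrix is Schur stable if all of its complex eigenvalues have
modulus strictly less than one. -/
def SchurStable {ι : Type} [Fintype ι] [DecidableEq ι] (M : Matrix ι ι ℝ) : Prop :=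
  ∀ μ ∈ spectrum ℂ (M.map (algebraMap ℝ ℂ)), ‖μ‖ < 1

open Filter Topology in
/-- In a complex Banach algebra, powers of an element of spectral radius `< 1` tend to zero. -/
theorem aux_pow_tendsto {R : Type*} [NormedRing R] [NormedAlgebra ℂ R] [CompleteSpace R]
    (a : R) (h : spectralRadius ℂ a < 1) : Tendsto (fun k : ℕ => ‖a ^ k‖) atTop (𝓝 0) := by
  obtain ⟨r, hr1, hr2⟩ := ENNReal.lt_iff_exists_nnreal_btwn.1 h
  have hr3 : r < 1 := by exact_mod_cast hr2
  have hg := spectrum.pow_nnnorm_pow_one_div_tendsto_nhds_spectralRadius a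
  have hev := hg.eventually_lt_const hr1
  have hb : ∀ᶠ k : ℕ in atTop, ‖a ^ k‖ ≤ (r : ℝ) ^ k := by
    filter_upwards [hev, eventually_gt_atTop 0] with k hk hk0
    have hk' : (0 : ℝ) < k := by exact_mod_cast hk0
    rw [one_div] at hk
    have h1 := (ENNReal.rpow_inv_le_iff hk').1 hk.le
    rw [ENNReal.rpow_natCast] at h1
    have h2 : ‖a ^ k‖₊ ≤ r ^ k := by exact_mod_cast h1
    exact_mod_cast h2
  refine squeeze_zero' (Eventually.of_forall fun _ => norm_nonneg _) hb ?_
  exact tendsto_pow_atTop_nhds_zero_of_lt_one r.2 (by exact_mod_cast hr3)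

section
attribute [local instance] Matrix.linftyOpNormedRing Matrix.linftyOpNormedAlgebra

open Filter Topology in
theorem aux_entry_tendsto {ι : Type} [Fintype ι] [DecidableEq ι] (M : Matrix ι ι ℝ)
    (hM : SchurStable M) (i j : ι) : Tendsto (fun k : ℕ => (M ^ k) i j) atTop (𝓝 0) := by
  haveI : Nonempty ι := ⟨i⟩
  haveI : CompleteSpace (Matrix ι ι ℂ) := FiniteDimensional.complete ℂ _
  have h1 : spectralRadius ℂ (M.map (algebraMap ℝ ℂ)) < ((1 : NNReal) : ENNReal) := by
    apply spectrum.spectralRadius_lt_of_forall_lt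
    intro μ hμ
    exact_mod_cast hM μ hμ
  have h2 := aux_pow_tendsto _ (by simpa using h1)
  refine squeeze_zero_norm (fun k => ?_) h2
  have h3 : (M.map (algebraMap ℝ ℂ)) ^ k = (M ^ k).map (algebraMap ℝ ℂ) :=
    (Matrix.map_pow M (algebraMap ℝ ℂ) k).symm
  have h4 : ‖(M.map (algebraMap ℝ ℂ) ^ k) i j‖ ≤ ‖M.map (algebraMap ℝ ℂ) ^ k‖ := by
    have h5 := Matrix.linfty_opNorm_mulVec (M.map (algebraMap ℝ ℂ) ^ k) (Pi.single j 1)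
    have h6 := norm_le_pi_norm ((M.map (algebraMap ℝ ℂ) ^ k) *ᵥ (Pi.single j 1)) i
    have h7 : ‖(Pi.single j 1 : ι → ℂ)‖ ≤ 1 := by
      refine (pi_norm_le_iff_of_nonneg zero_le_one).2 fun l => ?_
      by_cases hl : l = j
      · subst hl
        simp
      · simp [hl]
    have h8 := (h6.trans h5).trans (mul_le_of_le_one_right (norm_nonneg _) h7)
    simpa using h8
  refine le_trans (le_of_eq ?_) h4
  rw [h3]
  simp
end

/-- No nonzero eigenvector for eigenvalues of modulus at least one. -/
def NoEig {ι : Type} [Fintype ι] (M : Matrix ι ι ℝ) : Prop :=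
  ∀ (μ : ℂ) (v : ι → ℂ), 1 ≤ ‖μ‖ → (M.map (algebraMap ℝ ℂ)) *ᵥ v = μ • v → v = 0

open Filter Topology in
theorem aux_noEig_of_tendsto {ι : Type} [Fintype ι] [DecidableEq ι] (M : Matrix ι ι ℝ)
    (h : ∀ i j, Tendsto (fun k : ℕ => (M ^ k) i j) atTop (𝓝 0)) : NoEig M := by
  intro μ v hμ hv
  have hp : ∀ k : ℕ, ((M ^ k).map (algebraMap ℝ ℂ)) *ᵥ v = μ ^ k • v := by
    intro k
    induction k with
    | zero => simp
    | succ k ih =>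
      rw [pow_succ, Matrix.map_mul, ← Matrix.mulVec_mulVec, hv, Matrix.mulVec_smul, ih, smul_smul,
        pow_succ']
  funext i
  have h1 : Tendsto (fun k : ℕ => (((M ^ k).map (algebraMap ℝ ℂ)) *ᵥ v) i) atTop (𝓝 0) := by
    have : Tendsto (fun k : ℕ => ∑ j, ((M ^ k) i j : ℂ) * v j) atTop (𝓝 (∑ j, ((0 : ℝ) : ℂ) * v j)) := by
      refine tendsto_finsetSum _ fun j _ => ?_
      exact ((Complex.continuous_ofReal.tendsto _).comp (h i j)).mul_const _
    simpa [Matrix.mulVec, dotProduct] using this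
  have h2 : ∀ k : ℕ, ‖v i‖ ≤ ‖(((M ^ k).map (algebraMap ℝ ℂ)) *ᵥ v) i‖ := by
    intro k
    rw [hp k, Pi.smul_apply, smul_eq_mul, norm_mul, norm_pow]
    exact le_mul_of_one_le_left (norm_nonneg _) (one_le_pow₀ hμ)
  have h3 := ge_of_tendsto' h1.norm h2
  simpa using h3

theorem aux_stable_of_noEig {ι : Type} [Fintype ι] [DecidableEq ι] (M : Matrix ι ι ℝ)
    (h : NoEig M) : SchurStable M := by
  intro μ hμ
  by_contra hc
  rw [not_lt] at hc
  rw [← Matrix.spectrum_toLin', ← Module.End.hasEigenvalue_iff_mem_spectrum] at hμ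
  obtain ⟨v, hv⟩ := hμ.exists_hasEigenvector
  refine hv.2 (h μ v hc ?_)
  have := hv.apply_eq_smul
  simpa using this

theorem aux_step {κ α β : Type} [Fintype κ] [Fintype α] [DecidableEq α] [Fintype β]
    [DecidableEq β] {d : ℕ} (p : Fin d → ℝ) (q : κ → ℝ)
    (U : κ → Matrix α α ℝ) (V : κ → Matrix β β ℝ)
    (X : Fin d → Matrix α α ℝ) (Y : Fin d → Matrix β β ℝ) :
    (∑ t, q t • (U t ⊗ₖ V t)) * (∑ i, p i • (X i ⊗ₖ Y i)) =
      ∑ s : κ × Fin d, (q s.1 * p s.2) • ((U s.1 * X s.2) ⊗ₖ (V s.1 * Y s.2)) := by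
  rw [Finset.sum_mul_sum, Fintype.sum_prod_type]
  refine Finset.sum_congr rfl fun t _ => Finset.sum_congr rfl fun i _ => ?_
  rw [Matrix.mul_kronecker_mul, Matrix.smul_mul, Matrix.mul_smul, smul_smul]

theorem aux_words {α β : Type} [Fintype α] [DecidableEq α] [Fintype β] [DecidableEq β] {d : ℕ}
    (p : Fin d → ℝ) (hp : ∀ i, 0 < p i)
    (X : Fin d → Matrix α α ℝ) (Y : Fin d → Matrix β β ℝ) (k : ℕ) :
    ∃ (κ : Type) (_ : Fintype κ) (q : κ → ℝ) (U : κ → Matrix α α ℝ) (V : κ → Matrix β β ℝ),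
      (∀ t, 0 ≤ q t) ∧
      (∑ i, p i • (X i ⊗ₖ X i)) ^ k = ∑ t, q t • (U t ⊗ₖ U t) ∧
      (∑ i, p i • (Y i ⊗ₖ Y i)) ^ k = ∑ t, q t • (V t ⊗ₖ V t) ∧
      (∑ i, p i • (X i ⊗ₖ Y i)) ^ k = ∑ t, q t • (U t ⊗ₖ V t) := by
  induction k with
  | zero => exact ⟨Unit, inferInstance, fun _ => 1, fun _ => 1, fun _ => 1, by simp⟩
  | succ k ih =>
    obtain ⟨κ, _, q, U, V, hq, h1, h2, h3⟩ := ih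
    refine ⟨κ × Fin d, inferInstance, fun s => q s.1 * p s.2, fun s => U s.1 * X s.2,
      fun s => V s.1 * Y s.2, fun s => mul_nonneg (hq _) (hp _).le, ?_, ?_, ?_⟩
    · rw [pow_succ, h1, aux_step]
    · rw [pow_succ, h2, aux_step]
    · rw [pow_succ, h3, aux_step]

open Filter Topology in
theorem aux_mixed {α β : Type} [Fintype α] [DecidableEq α] [Fintype β] [DecidableEq β] {d : ℕ}
    (p : Fin d → ℝ) (hp : ∀ i, 0 < p i)
    (X : Fin d → Matrix α α ℝ) (Y : Fin d → Matrix β β ℝ)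
    (hX : SchurStable (∑ i, p i • (X i ⊗ₖ X i))) (hY : SchurStable (∑ i, p i • (Y i ⊗ₖ Y i))) :
    NoEig (∑ i, p i • (X i ⊗ₖ Y i)) := by
  apply aux_noEig_of_tendsto
  rintro ⟨a, b⟩ ⟨a', b'⟩
  have h := (aux_entry_tendsto _ hX (a, a) (a', a')).mul (aux_entry_tendsto _ hY (b, b) (b', b'))
  rw [mul_zero] at h
  have hs : Tendsto (fun k : ℕ => (((∑ i, p i • (X i ⊗ₖ Y i)) ^ k) (a, b) (a', b')) ^ 2)
      atTop (𝓝 0) := by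
    refine squeeze_zero (fun _ => sq_nonneg _) (fun k => ?_) h
    obtain ⟨κ, _, q, U, V, hq, h1, h2, h3⟩ := aux_words p hp X Y k
    rw [h1, h2, h3]
    simp only [Matrix.sum_apply, Matrix.smul_apply, Matrix.kroneckerMap_apply, smul_eq_mul]
    apply Finset.sum_sq_le_sum_mul_sum_of_sq_eq_mul
    · exact fun t _ => mul_nonneg (hq t) (mul_self_nonneg _)
    · exact fun t _ => mul_nonneg (hq t) (mul_self_nonneg _)
    · intro t _
      ring
  have h4 := hs.sqrt
  simp only [Real.sqrt_sq_eq_abs, Real.sqrt_zero] at h4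
  exact (tendsto_zero_iff_abs_tendsto_zero _).2 h4

/-- Explicit form of the eigenvector equation. -/
theorem aux_mulVec {α β : Type} [Fintype α] [Fintype β] {d : ℕ} (p : Fin d → ℝ)
    (X : Fin d → Matrix α α ℝ) (Y : Fin d → Matrix β β ℝ) (v : α × β → ℂ) (a : α) (b : β) :
    (((∑ i, p i • (X i ⊗ₖ Y i)).map (algebraMap ℝ ℂ)) *ᵥ v) (a, b) =
      ∑ x, ∑ y, (∑ i, (p i : ℂ) * ((X i a x : ℂ) * (Y i b y : ℂ))) * v (x, y) := by
  simp [Matrix.mulVec, dotProduct, Fintype.sum_prod_type, Matrix.sum_apply]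

theorem stmt0 (d m n : ℕ) (hd : 0 < d) (hm : 0 < m) (hn : 0 < n)
    (p : Fin d → ℝ) (hp : ∀ i, 0 < p i)
    (F : Fin d → Matrix (Fin m) (Fin m) ℝ)
    (A : Fin d → Matrix (Fin n) (Fin n) ℝ)
    (B : Fin d → Matrix (Fin m) (Fin n) ℝ)
    (hF : SchurStable (∑ i, p i • (F i ⊗ₖ F i)))
    (hA : SchurStable (∑ i, p i • (A i ⊗ₖ A i))) :
    SchurStable (∑ i, p i •
      (Matrix.fromBlocks (F i) (B i) 0 (A i) ⊗ₖ Matrix.fromBlocks (F i) (B i) 0 (A i))) := by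
  apply aux_stable_of_noEig
  intro μ v hμ hv
  have key : ∀ a b, _ = _ := fun a b => (aux_mulVec p _ _ v a b).symm.trans (congrFun hv (a, b))
  have e22 : ∀ a b, v (Sum.inr a, Sum.inr b) = 0 := by
    have := aux_mixed p hp A A hA hA μ (fun t => v (Sum.inr t.1, Sum.inr t.2)) hμ (by
      funext ⟨a, b⟩
      rw [aux_mulVec]
      have := key (Sum.inr a) (Sum.inr b)
      simpa [Fintype.sum_sum_type] using this)
    exact fun a b => congrFun this (a, b)
  have e12 : ∀ a b, v (Sum.inl a, Sum.inr b) = 0 := by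
    have := aux_mixed p hp F A hF hA μ (fun t => v (Sum.inl t.1, Sum.inr t.2)) hμ (by
      funext ⟨a, b⟩
      rw [aux_mulVec]
      have := key (Sum.inl a) (Sum.inr b)
      simpa [Fintype.sum_sum_type, e22] using this)
    exact fun a b => congrFun this (a, b)
  have e21 : ∀ a b, v (Sum.inr a, Sum.inl b) = 0 := by
    have := aux_mixed p hp A F hA hF μ (fun t => v (Sum.inr t.1, Sum.inl t.2)) hμ (by
      funext ⟨a, b⟩
      rw [aux_mulVec]
      have := key (Sum.inr a) (Sum.inl b)
      simpa [Fintype.sum_sum_type, e22] using this)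
    exact fun a b => congrFun this (a, b)
  have e11 : ∀ a b, v (Sum.inl a, Sum.inl b) = 0 := by
    have := aux_mixed p hp F F hF hF μ (fun t => v (Sum.inl t.1, Sum.inl t.2)) hμ (by
      funext ⟨a, b⟩
      rw [aux_mulVec]
      have := key (Sum.inl a) (Sum.inl b)
      simpa [Fintype.sum_sum_type, e22, e12, e21] using this)
    exact fun a b => congrFun this (a, b)
  funext ⟨a, b⟩
  rcases a with a | a <;> rcases b with b | b
  · exact e11 a b
  · exact e12 a b
  · exact e21 a b
  · exact e22 a b
end

section
/- Let d, n, n_m, m, p be positive integers, Σ = {1,…,d}, and p_1,…,p_d > 0. Let ({A_i, K_i}_{i=1}^d, C) be a dLPV-SSA of dimension n and ({A^m_i, K^m_i}_{i=1}^d, C^m) be a dLPV-SSA of dimension n_m with the same sub-Markov parameters, i.e. C A_w K_σ = C^m A^m_w K^m_σ for all w ∈ Σ*, σ ∈ Σ, and assume ({A^m_i, K^m_i}_{i=1}^d, C^m) is minimal. If Σ_{i=1}^d p_i ((A_i − K_i C) ⊗ (A_i − K_i C)) is Schur stable, then Σ_{i=1}^d p_i ((A^m_i − K^m_i C^m) ⊗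 (A^m_i − K^m_i C^m)) is Schur stable. -/
open Matrix
open scoped Kronecker

/-- A dLPV-SSA `({A_i, K_i}, C)` of dimension `n` is minimal if every dLPV-SSA of any
dimension `n'` with the same sub-Markov parameters `C A_w K_σ` satisfies `n' ≥ n`. -/
def IsMinimal (d m p n : ℕ)
    (A : Fin d → Matrix (Fin n) (Fin n) ℝ)
    (K : Fin d → Matrix (Fin n) (Fin m) ℝ)
    (C : Matrix (Fin p) (Fin n) ℝ) : Prop :=
  ∀ (n' : ℕ) (A' : Fin d → Matrix (Fin n') (Fin n') ℝ)
    (K' : Fin d → Matrix (Fin n') (Fin m) ℝ) (C' : Matrix (Fin p) (Fin n') ℝ),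
    (∀ (w : List (Fin d)) (σ : Fin d),
      C' * wordProd A' w * K' σ = C * wordProd A w * K σ) → n ≤ n'


section norms
attribute [local instance] Matrix.linftyOpNormedAddCommGroup Matrix.linftyOpNormedRing Matrix.linftyOpNormedAlgebra

lemma exists_small_pow {ι : Type} [Fintype ι] [DecidableEq ι] (N : Matrix ι ι ℂ)
    (h : ∀ μ ∈ spectrum ℂ N, ‖μ‖ < 1) (ε : ℝ) (hε : 0 < ε) : ∃ k : ℕ, ‖N ^ k‖ < ε := by
  by_cases hne : Nonempty ι
  swap
  · rw [not_nonempty_iff] at hne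
    exact ⟨0, by rw [Subsingleton.elim (N ^ 0) 0]; simpa using hε⟩
  have hr : spectralRadius ℂ N < (1 : NNReal) :=
    spectrum.spectralRadius_lt_of_forall_lt N (fun μ hμ => by
      have := h μ hμ
      exact_mod_cast this)
  obtain ⟨r, hr1, hr2⟩ := ENNReal.lt_iff_exists_nnreal_btwn.1 hr
  have ht := spectrum.pow_nnnorm_pow_one_div_tendsto_nhds_spectralRadius N
  have hev := ht.eventually (gt_mem_nhds hr1)
  have hr3 : (r : ℝ) < 1 := by exact_mod_cast hr2
  have hgeo := (tendsto_pow_atTop_nhds_zero_of_lt_one r.2 hr3).eventually (gt_mem_nhds hε)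
  obtain ⟨k, ⟨hk1, hk2⟩, hk3⟩ := ((hev.and hgeo).and (Filter.eventually_gt_atTop 0)).exists
  refine ⟨k, lt_of_le_of_lt ?_ hk2⟩
  have hk4 : (0 : ℝ) < k := by exact_mod_cast hk3
  have h1 : (‖N ^ k‖₊ : ENNReal) < (r : ENNReal) ^ (k : ℝ) := by
    rw [one_div, ENNReal.rpow_inv_lt_iff hk4] at hk1
    exact hk1
  rw [ENNReal.rpow_natCast] at h1
  have h2 : ‖N ^ k‖₊ < r ^ k := by exact_mod_cast h1
  exact_mod_cast h2.le

lemma schur_transfer {ι κ : Type} [Fintype ι] [DecidableEq ι] [Fintype κ] [DecidableEq κ]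
    (M : Matrix ι ι ℝ) (N : Matrix κ κ ℝ) (T : Matrix κ ι ℝ) (G : Matrix ι κ ℝ)
    (h : ∀ k : ℕ, T * M ^ k * G = N ^ k) (hM : SchurStable M) : SchurStable N := by
  intro μ hμ
  by_contra hlt
  push Not at hlt
  set f := algebraMap ℝ ℂ
  have hc : ∀ k : ℕ, (N.map f) ^ k = T.map f * (M.map f) ^ k * G.map f := by
    intro k
    have := congrArg (fun X => X.map f) (h k)
    simp only [Matrix.map_mul, Matrix.map_pow] at this
    exact this.symm
  set c := ‖T.map f‖ * ‖G.map f‖ * ‖(1 : Matrix κ κ ℂ)‖ with hcdef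
  have hc0 : 0 ≤ c := by positivity
  obtain ⟨k, hk⟩ := exists_small_pow (M.map f) hM (1 / (c + 1)) (by positivity)
  have h1 := spectrum.norm_le_norm_mul_of_mem (spectrum.pow_mem_pow _ k hμ)
  rw [hc, norm_pow] at h1
  have h2 : 1 ≤ ‖μ‖ ^ k := one_le_pow₀ hlt
  have h3 : ‖T.map f * (M.map f) ^ k * G.map f‖ ≤ ‖T.map f‖ * ‖(M.map f) ^ k‖ * ‖G.map f‖ :=
    (Matrix.linfty_opNorm_mul _ _).trans
      (mul_le_mul_of_nonneg_right (Matrix.linfty_opNorm_mul _ _) (norm_nonneg _))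
  have h4 : 1 ≤ c * ‖(M.map f) ^ k‖ := by
    calc 1 ≤ _ := h2
      _ ≤ _ := h1
      _ ≤ (‖T.map f‖ * ‖(M.map f) ^ k‖ * ‖G.map f‖) * ‖(1 : Matrix κ κ ℂ)‖ :=
        mul_le_mul_of_nonneg_right h3 (norm_nonneg _)
      _ = _ := by rw [hcdef]; ring
  rw [lt_div_iff₀ (by positivity)] at hk
  nlinarith [norm_nonneg ((M.map f) ^ k)]
end norms

lemma wordProd_append {d : ℕ} {ι : Type} [Fintype ι] [DecidableEq ι]
    (A : Fin d → Matrix ι ι ℝ) (s t : List (Fin d)) :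
    wordProd A (s ++ t) = wordProd A t * wordProd A s := by
  induction s with
  | nil => simp [wordProd]
  | cons a s ih => simp [wordProd, ih, Matrix.mul_assoc]

lemma wordProd_snoc {d : ℕ} {ι : Type} [Fintype ι] [DecidableEq ι]
    (A : Fin d → Matrix ι ι ℝ) (s : List (Fin d)) (i : Fin d) :
    wordProd A (s ++ [i]) = A i * wordProd A s := by
  rw [wordProd_append]; simp [wordProd]

lemma row_factor {n : ℕ} (W : Submodule ℝ (Fin n → ℝ)) {ι : Type} (X : Matrix ι (Fin n) ℝ)
    (h : ∀ i, X i ∈ W) :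
    ∃ Y : Matrix ι (Fin (Module.finrank ℝ W)) ℝ,
      X = Y * Matrix.of (fun i => ((Module.finBasis ℝ W i : W) : Fin n → ℝ)) := by
  refine ⟨Matrix.of fun i j => (Module.finBasis ℝ W).repr ⟨X i, h i⟩ j, ?_⟩
  ext i j
  have := congrArg (fun x : W => (x : Fin n → ℝ) j)
    ((Module.finBasis ℝ W).sum_repr ⟨X i, h i⟩)
  simp only [Submodule.coe_sum, Submodule.coe_smul, Finset.sum_apply, Pi.smul_apply,
    smul_eq_mul] at this
  rw [Matrix.mul_apply]
  exact this.symm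

lemma obs_top {d m p n : ℕ} (A : Fin d → Matrix (Fin n) (Fin n) ℝ)
    (K : Fin d → Matrix (Fin n) (Fin m) ℝ) (C : Matrix (Fin p) (Fin n) ℝ)
    (hmin : IsMinimal d m p n A K C) :
    Submodule.span ℝ (Set.range fun q : List (Fin d) × Fin p => (C * wordProd A q.1) q.2) = ⊤ := by
  set W := Submodule.span ℝ
    (Set.range fun q : List (Fin d) × Fin p => (C * wordProd A q.1) q.2) with hW
  set E : Matrix (Fin (Module.finrank ℝ W)) (Fin n) ℝ :=
    Matrix.of (fun i => ((Module.finBasis ℝ W i : W) : Fin n → ℝ)) with hE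
  obtain ⟨C', hC'⟩ := row_factor W C (fun j =>
    Submodule.subset_span ⟨([], j), by simp [wordProd]⟩)
  have hinv : ∀ i, ∀ x ∈ W, x ᵥ* A i ∈ W := by
    intro i x hx
    induction hx using Submodule.span_induction with
    | mem x hx =>
      obtain ⟨⟨w, j⟩, rfl⟩ := hx
      refine Submodule.subset_span ⟨(i :: w, j), ?_⟩
      simp only [wordProd, ← Matrix.mul_assoc]
      rfl
    | zero => simp
    | add x y _ _ hx hy => rw [Matrix.add_vecMul]; exact W.add_mem hx hy
    | smul a x _ hx => rw [Matrix.smul_vecMul]; exact W.smul_mem a hx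
  have hA' : ∀ i, ∃ Y : Matrix (Fin (Module.finrank ℝ W)) (Fin (Module.finrank ℝ W)) ℝ, E * A i = Y * E := fun i =>
    row_factor W (E * A i) (fun k => hinv i (E k) (Module.finBasis ℝ W k).2)
  choose A' hA' using hA'
  have hw : ∀ w, E * wordProd A w = wordProd A' w * E := by
    intro w
    induction w using List.reverseRecOn with
    | nil => simp [wordProd]
    | append_singleton s i ih =>
      rw [wordProd_snoc, wordProd_snoc, ← Matrix.mul_assoc, hA', Matrix.mul_assoc, ih,
        Matrix.mul_assoc]
  have := hmin _ A' (fun i => E * K i) C' (fun w σ => by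
    rw [← Matrix.mul_assoc, Matrix.mul_assoc C', ← hw, ← Matrix.mul_assoc, ← hC'])
  apply Submodule.eq_top_of_finrank_eq
  have h2 := Submodule.finrank_le W
  simp at h2 ⊢
  omega

lemma reach_top {d m p n : ℕ} (A : Fin d → Matrix (Fin n) (Fin n) ℝ)
    (K : Fin d → Matrix (Fin n) (Fin m) ℝ) (C : Matrix (Fin p) (Fin n) ℝ)
    (hmin : IsMinimal d m p n A K C) :
    Submodule.span ℝ (Set.range fun q : List (Fin d) × Fin d × Fin m =>
      (wordProd A q.1 * K q.2.1)ᵀ q.2.2) = ⊤ := by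
  set W := Submodule.span ℝ (Set.range fun q : List (Fin d) × Fin d × Fin m =>
      (wordProd A q.1 * K q.2.1)ᵀ q.2.2) with hW
  set E : Matrix (Fin (Module.finrank ℝ W)) (Fin n) ℝ :=
    Matrix.of (fun i => ((Module.finBasis ℝ W i : W) : Fin n → ℝ)) with hE
  have hK' : ∀ σ, ∃ Y : Matrix (Fin m) (Fin (Module.finrank ℝ W)) ℝ, (K σ)ᵀ = Y * E := fun σ =>
    row_factor W (K σ)ᵀ (fun j => Submodule.subset_span ⟨([], σ, j), by simp [wordProd]⟩)
  choose K' hK' using hK'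
  have hinv : ∀ i, ∀ x ∈ W, A i *ᵥ x ∈ W := by
    intro i x hx
    induction hx using Submodule.span_induction with
    | mem x hx =>
      obtain ⟨⟨w, σ, j⟩, rfl⟩ := hx
      refine Submodule.subset_span ⟨(w ++ [i], σ, j), ?_⟩
      simp only [wordProd_snoc, Matrix.mul_assoc]
      rfl
    | zero => simp
    | add x y _ _ hx hy => rw [Matrix.mulVec_add]; exact W.add_mem hx hy
    | smul a x _ hx => rw [Matrix.mulVec_smul]; exact W.smul_mem a hx
  have hA' : ∀ i, ∃ Y : Matrix (Fin (Module.finrank ℝ W)) (Fin (Module.finrank ℝ W)) ℝ, E * (A i)ᵀ = Y * E := fun i =>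
    row_factor W (E * (A i)ᵀ) (fun k => by
      have h1 := hinv i (E k) (Module.finBasis ℝ W k).2
      rw [← Matrix.vecMul_transpose] at h1
      exact h1)
  choose A' hA' using hA'
  have hA2 : ∀ i, A i * Eᵀ = Eᵀ * (A' i)ᵀ := fun i => by
    have := congrArg Matrix.transpose (hA' i)
    simpa [Matrix.transpose_mul] using this
  have hK2 : ∀ i, K i = Eᵀ * (K' i)ᵀ := fun i => by
    have := congrArg Matrix.transpose (hK' i)
    simpa [Matrix.transpose_mul] using this
  have hw : ∀ w, wordProd A w * Eᵀ = Eᵀ * wordProd (fun i => (A' i)ᵀ) w := by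
    intro w
    induction w with
    | nil => simp [wordProd]
    | cons i s ih =>
      simp only [wordProd]
      rw [Matrix.mul_assoc, hA2, ← Matrix.mul_assoc, ih, Matrix.mul_assoc]
  have := hmin _ (fun i => (A' i)ᵀ) (fun i => (K' i)ᵀ) (C * Eᵀ) (fun w σ => by
    rw [Matrix.mul_assoc C, ← hw, hK2 σ]
    simp only [Matrix.mul_assoc])
  apply Submodule.eq_top_of_finrank_eq
  have h2 := Submodule.finrank_le W
  simp at h2 ⊢
  omega

/-- Lift: if the second components span, unit vectors lift to the span of pairs. -/
lemma exists_lift {Q : Type} {n k : ℕ} (f : Q → Fin n → ℝ) (g : Q → Fin k → ℝ)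
    (h : Submodule.span ℝ (Set.range g) = ⊤) (y : Fin k → ℝ) :
    ∃ x, (x, y) ∈ Submodule.span ℝ (Set.range fun q => (f q, g q)) := by
  have h1 : (Submodule.span ℝ (Set.range fun q => (f q, g q))).map
      (LinearMap.snd ℝ (Fin n → ℝ) (Fin k → ℝ)) = ⊤ := by
    rw [Submodule.map_span, ← Set.range_comp, ← h]
    rfl
  have h2 : y ∈ (Submodule.span ℝ (Set.range fun q => (f q, g q))).map
      (LinearMap.snd ℝ (Fin n → ℝ) (Fin k → ℝ)) := by rw [h1]; trivial
  obtain ⟨⟨a, b⟩, hab, hb⟩ := h2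
  simp only [LinearMap.snd_apply] at hb
  subst hb
  exact ⟨a, hab⟩

theorem stmt11 (d n nm m : ℕ) (hd : 0 < d) (hn : 0 < n) (hnm : 0 < nm) (hm : 0 < m)
    (p : Fin d → ℝ) (hp : ∀ i, 0 < p i)
    (A : Fin d → Matrix (Fin n) (Fin n) ℝ)
    (K : Fin d → Matrix (Fin n) (Fin m) ℝ)
    (C : Matrix (Fin m) (Fin n) ℝ)
    (Am : Fin d → Matrix (Fin nm) (Fin nm) ℝ)
    (Km : Fin d → Matrix (Fin nm) (Fin m) ℝ)
    (Cm : Matrix (Fin m) (Fin nm) ℝ)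
    (hsame : ∀ (w : List (Fin d)) (σ : Fin d),
      C * wordProd A w * K σ = Cm * wordProd Am w * Km σ)
    (hmin : IsMinimal d m m nm Am Km Cm)
    (hstab : SchurStable (∑ i, p i • ((A i - K i * C) ⊗ₖ (A i - K i * C)))) :
    SchurStable (∑ i, p i • ((Am i - Km i * Cm) ⊗ₖ (Am i - Km i * Cm))) := by
  -- the observability lift `T`
  have hT1 := fun i : Fin nm => exists_lift
    (fun q : List (Fin d) × Fin m => (C * wordProd A q.1) q.2) _
    (obs_top Am Km Cm hmin) ((1 : Matrix (Fin nm) (Fin nm) ℝ) i)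
  choose T hT using hT1
  have hTp : ∀ x ∈ Submodule.span ℝ (Set.range fun q : List (Fin d) × Fin m =>
      ((C * wordProd A q.1) q.2, (Cm * wordProd Am q.1) q.2)), ∀ v σ,
      x.1 ᵥ* (wordProd A v * K σ) = x.2 ᵥ* (wordProd Am v * Km σ) := by
    intro x hx v σ
    induction hx using Submodule.span_induction with
    | mem x hx =>
      obtain ⟨⟨w, j⟩, rfl⟩ := hx
      have h1 := hsame (v ++ w) σ
      rw [wordProd_append, wordProd_append] at h1
      have h2 : (C * wordProd A w) * (wordProd A v * K σ)
          = (Cm * wordProd Am w) * (wordProd Am v * Km σ) := by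
        simpa only [Matrix.mul_assoc] using h1
      exact congrFun h2 j
    | zero => simp
    | add x y _ _ hx hy => simp only [Prod.fst_add, Prod.snd_add, Matrix.add_vecMul, hx, hy]
    | smul a x _ hx => simp only [Prod.smul_fst, Prod.smul_snd, Matrix.smul_vecMul, hx]
  have hTA : ∀ v σ, Matrix.of T * (wordProd A v * K σ) = wordProd Am v * Km σ := by
    intro v σ
    conv_rhs => rw [← Matrix.one_mul (wordProd Am v * Km σ)]
    funext i
    exact hTp _ (hT i) v σ
  -- the reachability lift `G`
  have hG1 := fun i : Fin nm => exists_lift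
    (fun q : List (Fin d) × Fin d × Fin m => (wordProd A q.1 * K q.2.1)ᵀ q.2.2) _
    (reach_top Am Km Cm hmin) ((1 : Matrix (Fin nm) (Fin nm) ℝ) i)
  choose G hG using hG1
  have hGp : ∀ {r : ℕ} (X : Matrix (Fin r) (Fin n) ℝ) (Xm : Matrix (Fin r) (Fin nm) ℝ),
      (∀ v σ, X * (wordProd A v * K σ) = Xm * (wordProd Am v * Km σ)) →
      X * (Matrix.of G)ᵀ = Xm := by
    intro r X Xm hX
    have key : ∀ x ∈ Submodule.span ℝ (Set.range fun q : List (Fin d) × Fin d × Fin m =>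
        ((wordProd A q.1 * K q.2.1)ᵀ q.2.2, (wordProd Am q.1 * Km q.2.1)ᵀ q.2.2)),
        X *ᵥ x.1 = Xm *ᵥ x.2 := by
      intro x hx
      induction hx using Submodule.span_induction with
      | mem x hx =>
        obtain ⟨⟨w, σ, j⟩, rfl⟩ := hx
        exact congrFun (congrArg Matrix.transpose (hX w σ)) j
      | zero => simp
      | add x y _ _ hx hy => simp only [Prod.fst_add, Prod.snd_add, Matrix.mulVec_add, hx, hy]
      | smul a x _ hx => simp only [Prod.smul_fst, Prod.smul_snd, Matrix.mulVec_smul, hx]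
    have h1 : X * (Matrix.of G)ᵀ = Xm * (1 : Matrix (Fin nm) (Fin nm) ℝ)ᵀ := by
      ext i j
      exact congrFun (key _ (hG j)) i
    simpa using h1
  set T' : Matrix (Fin nm) (Fin n) ℝ := Matrix.of T
  set G' : Matrix (Fin n) (Fin nm) ℝ := (Matrix.of G)ᵀ
  have hCG : ∀ v, C * wordProd A v * G' = Cm * wordProd Am v := by
    intro v
    apply hGp
    intro w σ
    have h1 := hsame (w ++ v) σ
    rw [wordProd_append, wordProd_append] at h1
    simpa only [Matrix.mul_assoc] using h1
  have hTG : ∀ v, T' * wordProd A v * G' = wordProd Am v := by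
    intro v
    apply hGp
    intro w σ
    have h1 := hTA (w ++ v) σ
    rw [wordProd_append, wordProd_append] at h1
    simpa only [Matrix.mul_assoc] using h1
  set B := fun i => A i - K i * C with hB
  set Bm := fun i => Am i - Km i * Cm with hBm
  have hall : ∀ w v, C * wordProd A v * (wordProd B w * G') = Cm * wordProd Am v * wordProd Bm w
      ∧ T' * wordProd A v * (wordProd B w * G') = wordProd Am v * wordProd Bm w := by
    intro w
    induction w using List.reverseRecOn with
    | nil => intro v; simp [wordProd, hCG, hTG]
    | append_singleton s i ih =>
      intro v
      have e0 := (ih []).1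
      have e1 := ih (i :: v)
      simp only [wordProd, Matrix.mul_one] at e0 e1
      have a1 : ∀ {r : ℕ} (X : Matrix (Fin r) (Fin n) ℝ),
          X * wordProd A v * (wordProd B (s ++ [i]) * G')
          = X * (wordProd A v * A i) * (wordProd B s * G')
            - X * (wordProd A v * K i) * (C * (wordProd B s * G')) := by
        intro r X
        rw [wordProd_snoc]
        simp only [hB, Matrix.sub_mul, Matrix.mul_sub, Matrix.mul_assoc]
      have a2 : wordProd Am v * wordProd Bm (s ++ [i])
          = wordProd Am v * Am i * wordProd Bm s
            - wordProd Am v * Km i * (Cm * wordProd Bm s) := by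
        rw [wordProd_snoc]
        simp only [hBm, Matrix.sub_mul, Matrix.mul_sub, Matrix.mul_assoc]
      constructor
      · rw [a1, e0, e1.1, Matrix.mul_assoc Cm (wordProd Am v), a2, ← Matrix.mul_assoc C, hsame, Matrix.mul_sub]
        simp only [Matrix.mul_assoc]
      · rw [a1, e0, e1.2, a2, hTA]
  have hBw : ∀ w, T' * wordProd B w * G' = wordProd Bm w := by
    intro w
    have := (hall w []).2
    simpa [wordProd, Matrix.mul_assoc] using this
  refine schur_transfer _ _ (T' ⊗ₖ T') (G' ⊗ₖ G') (fun k => ?_) hstab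
  have hspan : ((∑ i, p i • (B i ⊗ₖ B i)) ^ k, (∑ i, p i • (Bm i ⊗ₖ Bm i)) ^ k) ∈
      Submodule.span ℝ (Set.range fun w : List (Fin d) =>
        (wordProd B w ⊗ₖ wordProd B w, wordProd Bm w ⊗ₖ wordProd Bm w)) := by
    induction k with
    | zero => exact Submodule.subset_span ⟨[], by simp [wordProd]⟩
    | succ k ih =>
      simp only [pow_succ']
      generalize (∑ i, p i • (B i ⊗ₖ B i)) ^ k = X at ih ⊢
      generalize (∑ i, p i • (Bm i ⊗ₖ Bm i)) ^ k = Xm at ih ⊢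
      have step : ∀ x ∈ Submodule.span ℝ (Set.range fun w : List (Fin d) =>
          (wordProd B w ⊗ₖ wordProd B w, wordProd Bm w ⊗ₖ wordProd Bm w)), ∀ i,
          (B i ⊗ₖ B i * x.1, Bm i ⊗ₖ Bm i * x.2) ∈
          Submodule.span ℝ (Set.range fun w : List (Fin d) =>
          (wordProd B w ⊗ₖ wordProd B w, wordProd Bm w ⊗ₖ wordProd Bm w)) := by
        intro x hx i
        induction hx using Submodule.span_induction with
        | mem x hx =>
          obtain ⟨w, rfl⟩ := hx
          refine Submodule.subset_span ⟨w ++ [i], ?_⟩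
          simp only [wordProd_snoc, Matrix.mul_kronecker_mul]
        | zero =>
          simp only [Prod.fst_zero, Prod.snd_zero, Matrix.mul_zero]
          exact Submodule.zero_mem _
        | add x y _ _ hx hy =>
          have := Submodule.add_mem _ hx hy
          simpa only [Prod.fst_add, Prod.snd_add, Matrix.mul_add, Prod.mk_add_mk] using this
        | smul a x _ hx =>
          have := Submodule.smul_mem _ a hx
          simpa only [Prod.smul_fst, Prod.smul_snd, Matrix.mul_smul, Prod.smul_mk] using this
      have h1 := Submodule.sum_mem _ (fun i (_ : i ∈ Finset.univ) =>
        Submodule.smul_mem _ (p i) (step _ ih i))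
      convert h1 using 1
      ext1
      · simp [Prod.fst_sum, Finset.sum_mul]
      · simp [Prod.snd_sum, Finset.sum_mul]
  have hlin : ∀ x ∈ Submodule.span ℝ (Set.range fun w : List (Fin d) =>
      (wordProd B w ⊗ₖ wordProd B w, wordProd Bm w ⊗ₖ wordProd Bm w)),
      (T' ⊗ₖ T') * x.1 * (G' ⊗ₖ G') = x.2 := by
    intro x hx
    induction hx using Submodule.span_induction with
    | mem x hx =>
      obtain ⟨w, rfl⟩ := hx
      simp only [← Matrix.mul_kronecker_mul, hBw]
    | zero => simp
    | add x y _ _ hx hy =>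
      simp only [Prod.fst_add, Prod.snd_add, Matrix.mul_add, Matrix.add_mul, hx, hy]
    | smul a x _ hx =>
      simp only [Prod.smul_fst, Prod.smul_snd, Matrix.mul_smul, Matrix.smul_mul, hx]
  exact hlin _ hspan
end
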